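/- arXiv:1601.07821 — 2 statements merged into one kernel-verified Lean document; each statement's English description precedes it below -/
import Mathlib

section
/- Every uniformly convex real Banach space X has the local directional Bishop-Phelps-Bollobás property for Lipschitz functionals: for every ε > 0 there is δ > 0 such that for every f ∈ Lip_0(X) with ‖f‖ = 1 and every x,y ∈ X with x ≠ y satisfying (f(x)-f(y))/‖x-y‖ > 1-δ, there exist g ∈ Lip_0(X) with ‖g‖ = 1, v ∈ X and u ∈ S_X such that g attains its norm in the point v at the direction u, ‖g-f‖ < ε, ‖(x-y)/‖x-y‖ - u‖ < ε, and dist(v, conv{x,y}) < ε. -/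
open Filter Topology

/-- `L` is the smallest Lipschitz constant of `f` (the Lipschitz norm of `f`). -/
def IsLipNorm {E : Type*} [PseudoMetricSpace E] (f : E → ℝ) (L : ℝ) : Prop :=
  IsLeast {K : ℝ | 0 ≤ K ∧ ∀ x y : E, |f x - f y| ≤ K * dist x y} L

/-- `g` (with Lipschitz norm `L`) attains its norm in the point `v` at the direction `u`. -/
def AttainsAtPointDirection {X : Type*} [NormedAddCommGroup X] [NormedSpace ℝ X]
    (g : X → ℝ) (L : ℝ) (v u : X) : Prop :=
  ∃ xs ys : ℕ → X, (∀ n, xs n ≠ ys n) ∧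
    Tendsto xs atTop (𝓝 v) ∧ Tendsto ys atTop (𝓝 v) ∧
    Tendsto (fun n => ‖xs n - ys n‖⁻¹ • (xs n - ys n)) atTop (𝓝 u) ∧
    Tendsto (fun n => (g (xs n) - g (ys n)) / ‖xs n - ys n‖) atTop (𝓝 L)

/-- `X` has the local directional Bishop-Phelps-Bollobás property for Lipschitz
functionals. -/
def LocalDirLipBPB (X : Type*) [NormedAddCommGroup X] [NormedSpace ℝ X] : Prop :=
  ∀ ε > (0:ℝ), ∃ δ > (0:ℝ), ∀ f : X → ℝ, f 0 = 0 → IsLipNorm f 1 →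
    ∀ x y : X, x ≠ y → (f x - f y) / ‖x - y‖ > 1 - δ →
      ∃ g : X → ℝ, g 0 = 0 ∧ IsLipNorm g 1 ∧
        ∃ v u : X, ‖u‖ = 1 ∧ AttainsAtPointDirection g 1 v u ∧
          (∃ M : ℝ, IsLipNorm (fun z => g z - f z) M ∧ M < ε) ∧
          ‖‖x - y‖⁻¹ • (x - y) - u‖ < ε ∧
          Metric.infDist v (segment ℝ x y) < ε

theorem IsLipNorm.exists_le {E : Type*} [PseudoMetricSpace E] {f : E → ℝ} {K : ℝ} (hK : 0 ≤ K)
    (h : ∀ x y, |f x - f y| ≤ K * dist x y) : ∃ M, IsLipNorm f M ∧ M ≤ K := by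
  have hbdd : BddBelow {K : ℝ | 0 ≤ K ∧ ∀ x y : E, |f x - f y| ≤ K * dist x y} :=
    ⟨0, fun _ hM => hM.1⟩
  have hcl : IsClosed {K : ℝ | 0 ≤ K ∧ ∀ x y : E, |f x - f y| ≤ K * dist x y} := by
    simp only [Set.ofPred_and, Set.ofPred_forall]
    exact (isClosed_le (by fun_prop) (by fun_prop)).inter (isClosed_iInter fun x =>
      isClosed_iInter fun y => isClosed_le (by fun_prop) (by fun_prop))
  exact ⟨_, hcl.isLeast_csInf ⟨K, hK, h⟩ hbdd, csInf_le hbdd ⟨hK, h⟩⟩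

theorem IsLipNorm.le_add {E : Type*} [PseudoMetricSpace E] {f g : E → ℝ} {L M T : ℝ}
    (hf : IsLipNorm f L) (hg : IsLipNorm g M) (hT : 0 ≤ T)
    (h : ∀ x y, |(f x - f y) - (g x - g y)| ≤ T * dist x y) : L ≤ M + T := by
  refine hf.2 ⟨add_nonneg hg.1.1 hT, fun x y => ?_⟩
  have h1 := h x y
  have h2 := hg.1.2 x y
  rw [abs_le] at *
  constructor <;> linarith

theorem IsLipNorm.div_self {E : Type*} [PseudoMetricSpace E] {f : E → ℝ} {L : ℝ} (hf : IsLipNorm f L) (hL : 0 < L) :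
    IsLipNorm (fun z => f z / L) 1 := by
  refine ⟨⟨zero_le_one, fun x y => ?_⟩, fun K hK => ?_⟩
  · rw [← sub_div, abs_div, abs_of_pos hL, div_le_iff₀ hL]
    linarith [hf.1.2 x y]
  · have : L ≤ K * L := hf.2 ⟨mul_nonneg hK.1 hL.le, fun x y => by
      have h := hK.2 x y
      rw [← sub_div, abs_div, abs_of_pos hL, div_le_iff₀ hL] at h
      linarith⟩
    exact le_of_mul_le_mul_right (by linarith) hL

theorem IsLipNorm.exists_pair {X : Type*} [NormedAddCommGroup X] {f : X → ℝ} {L c : ℝ} (hf : IsLipNorm f L) (hc : 0 ≤ c)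
    (hcL : c < L) : ∃ p q : X, p ≠ q ∧ c * ‖p - q‖ < f p - f q := by
  by_contra! H
  refine hcL.not_ge (hf.2 ⟨hc, fun p q => ?_⟩)
  have key : ∀ p q : X, f p - f q ≤ c * dist p q := fun p q => by
    rcases eq_or_ne p q with rfl | hpq
    · simp
    · simpa [dist_eq_norm] using H p q hpq
  rw [abs_le]
  have := key q p
  rw [dist_comm] at this
  exact ⟨by linarith, key p q⟩

section Normed

variable {X : Type*} [NormedAddCommGroup X] [NormedSpace ℝ X]

/-- A steep pair contains an arbitrarily close pair, with the same direction, that is as steep. -/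
theorem exists_close_pair_of_steep {f : X → ℝ} {c r : ℝ} {x y : X} (hxy : x ≠ y)
    (h : c * ‖x - y‖ < f x - f y) (hr : 0 < r) :
    ∃ p q : X, p ∈ segment ℝ x y ∧ p ≠ q ∧ ‖p - q‖ < r ∧
      ‖p - q‖⁻¹ • (p - q) = ‖x - y‖⁻¹ • (x - y) ∧ c * ‖p - q‖ < f p - f q := by
  obtain ⟨n, hn⟩ := exists_nat_gt (‖x - y‖ / r)
  have hpos : 0 < ‖x - y‖ := norm_pos_iff.2 (sub_ne_zero.2 hxy)
  have hn0 : (0 : ℝ) < n := (div_pos hpos hr).trans hn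
  let z : ℕ → X := fun k => y + ((k : ℝ) / n) • (x - y)
  have hz0 : z 0 = y := by simp [z]
  have hzn : z n = x := by simp [z, div_self hn0.ne']
  have hdiff : ∀ k, z (k + 1) - z k = (n : ℝ)⁻¹ • (x - y) := fun k => by
    simp only [z, add_sub_add_left_eq_sub, ← sub_smul]
    congr 1
    push_cast
    field_simp
    ring
  have hnorm : ∀ k, ‖z (k + 1) - z k‖ = (n : ℝ)⁻¹ * ‖x - y‖ := fun k => by
    rw [hdiff, norm_smul, Real.norm_of_nonneg (inv_nonneg.2 hn0.le)]
  have hsum : ∑ k ∈ Finset.range n, c * ‖z (k + 1) - z k‖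
      < ∑ k ∈ Finset.range n, (f (z (k + 1)) - f (z k)) := by
    rw [Finset.sum_range_sub (fun k => f (z k)), hz0, hzn]
    simp only [hnorm, Finset.sum_const, Finset.card_range, nsmul_eq_mul]
    calc (n : ℝ) * (c * ((n : ℝ)⁻¹ * ‖x - y‖)) = c * ‖x - y‖ := by field_simp
      _ < _ := h
  obtain ⟨k, hk, hlt⟩ := Finset.exists_lt_of_sum_lt hsum
  have hkn : k + 1 ≤ n := Finset.mem_range.1 hk
  refine ⟨z (k + 1), z k, ?_, ?_, ?_, ?_, hlt⟩
  · rw [segment_symm, segment_eq_image']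
    exact ⟨_, ⟨by positivity, (div_le_one hn0).2 (by exact_mod_cast hkn)⟩, rfl⟩
  · rw [← sub_ne_zero, ← norm_ne_zero_iff, hnorm]
    positivity
  · rw [hnorm, inv_mul_eq_div, div_lt_iff₀ hn0]
    rwa [div_lt_iff₀ hr, mul_comm] at hn
  · rw [hnorm, hdiff, smul_smul]
    congr 1
    field_simp

/-- A perturbation which is steep at a given pair, and only at pairs close to it in both position
and direction. -/
theorem exists_localizing_perturbation {x y : X} {r : ℝ} (hxy : x ≠ y) (hr : ‖x - y‖ < r) :
    ∃ ψ : X → ℝ, ψ 0 = 0 ∧ (∀ p q, |ψ p - ψ q| ≤ 2 * ‖p - q‖) ∧ ψ x - ψ y = 2 * ‖x - y‖ ∧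
      ∀ p q d, p ≠ q → d ≤ 1 → (2 - d) * ‖p - q‖ < ψ p - ψ q →
        ‖p - x‖ < r ∧ 2 - d < ‖‖x - y‖⁻¹ • (x - y) + ‖p - q‖⁻¹ • (p - q)‖ := by
  obtain ⟨l, hl, hlxy⟩ := exists_dual_vector ℝ (x - y) (norm_ne_zero_iff.2 (sub_ne_zero.2 hxy))
  have hlxy' : l (x - y) = ‖x - y‖ := by simpa using hlxy
  let φ : X → ℝ := fun z => max (r - ‖z - x‖) 0
  have hφ : ∀ p q, |φ p - φ q| ≤ ‖p - q‖ := fun p q => by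
    refine (abs_max_sub_max_le_abs _ _ _).trans ?_
    calc |r - ‖p - x‖ - (r - ‖q - x‖)| = |‖q - x‖ - ‖p - x‖| := by congr 1; ring
      _ ≤ ‖(q - x) - (p - x)‖ := abs_norm_sub_norm_le _ _
      _ = ‖p - q‖ := by rw [sub_sub_sub_cancel_right, norm_sub_rev]
  have hlle : ∀ z, |l z| ≤ ‖z‖ := fun z => by simpa [hl] using l.le_opNorm z
  refine ⟨fun z => l z + (φ z - φ 0), by simp, fun p q => ?_, ?_, fun p q d hpq hd h => ?_⟩
  · have h1 := hφ p q
    have h2 := hlle (p - q)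
    rw [map_sub] at h2
    rw [abs_le] at *
    constructor <;> linarith
  · have h1 : φ x = r := by
      simp only [φ, sub_self, norm_zero, sub_zero]
      exact max_eq_left ((norm_nonneg _).trans hr.le)
    have h2 : φ y = r - ‖x - y‖ := by
      simp only [φ]
      rw [norm_sub_rev, max_eq_left (by linarith)]
    rw [map_sub] at hlxy'
    change l x + (φ x - φ 0) - (l y + (φ y - φ 0)) = _
    rw [h1, h2]
    linarith
  · have hpos : 0 < ‖p - q‖ := norm_pos_iff.2 (sub_ne_zero.2 hpq)
    have hposxy : 0 < ‖x - y‖ := norm_pos_iff.2 (sub_ne_zero.2 hxy)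
    have h1 := (abs_le.1 (hφ p q)).2
    have h2 := (abs_le.1 (hlle (p - q))).2
    have h3 : l (p - q) = l p - l q := map_sub _ _ _
    have h4 : d * ‖p - q‖ ≤ ‖p - q‖ := by nlinarith
    constructor
    · by_contra! H
      have h5 : φ p = 0 := max_eq_right (by linarith)
      have h6 : 0 ≤ φ q := le_max_right _ _
      linarith
    · refine lt_of_lt_of_le ?_ ((le_abs_self _).trans (hlle _))
      have h5 : (1 - d) * ‖p - q‖ < l (p - q) := by linarith
      rw [map_add, map_smul, map_smul, hlxy', smul_eq_mul, smul_eq_mul,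
        inv_mul_cancel₀ hposxy.ne', inv_mul_eq_div]
      have := (lt_div_iff₀ hpos).2 h5
      linarith

/-- One perturbation step: a `τ * d`-steep pair of `f` yields a steeper pair of a small
perturbation of `f`, close to the first pair in both position and direction. -/
theorem IsLipNorm.exists_perturbation {f : X → ℝ} {L τ r η d : ℝ} {x y : X} (hf : IsLipNorm f L)
    (hf0 : f 0 = 0) (hτ : 0 < τ) (hd1 : d ≤ 1)
    (hη : ∀ u : X, ‖u‖ = 1 → ∀ v : X, ‖v‖ = 1 → η ≤ ‖u - v‖ → ‖u + v‖ ≤ 2 - d)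
    (hxy : x ≠ y) (hr : ‖x - y‖ < r) (h : (L - τ * d) * ‖x - y‖ < f x - f y)
    {r' δ' : ℝ} (hr' : 0 < r') (hδ' : 0 < δ') :
    ∃ (g : X → ℝ) (p q : X) (M : ℝ), g 0 = 0 ∧ IsLipNorm g M ∧ p ≠ q ∧ ‖p - q‖ < r' ∧
      (M - δ') * ‖p - q‖ < g p - g q ∧
      (∀ a b, |(g a - g b) - (f a - f b)| ≤ 2 * τ * ‖a - b‖) ∧ ‖p - x‖ < r ∧
      ‖‖x - y‖⁻¹ • (x - y) - ‖p - q‖⁻¹ • (p - q)‖ < η := by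
  obtain ⟨ψ, hψ0, hψ, hψxy, hloc⟩ := exists_localizing_perturbation hxy hr
  have hpos : 0 < ‖x - y‖ := norm_pos_iff.2 (sub_ne_zero.2 hxy)
  have hL := hf.1.1
  have hgf : ∀ a b, |((f a + τ * ψ a) - (f b + τ * ψ b)) - (f a - f b)| ≤ 2 * τ * ‖a - b‖ := by
    intro a b
    calc _ = |τ * (ψ a - ψ b)| := by congr 1; ring
      _ = τ * |ψ a - ψ b| := by rw [abs_mul, abs_of_pos hτ]
      _ ≤ τ * (2 * ‖a - b‖) := by gcongr; exact hψ a b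
      _ = _ := by ring
  obtain ⟨M, hM, -⟩ : ∃ M, IsLipNorm (fun z => f z + τ * ψ z) M ∧ M ≤ L + 2 * τ := by
    refine IsLipNorm.exists_le (by positivity) fun a b => ?_
    have h1 := hgf a b
    have h2 := hf.1.2 a b
    rw [dist_eq_norm] at *
    rw [abs_le] at *
    constructor <;> linarith
  have hlt : L - τ * d + 2 * τ < M := by
    have h1 := (abs_le.1 (hM.1.2 x y)).2
    rw [dist_eq_norm] at h1
    have h2 : τ * (ψ x - ψ y) = τ * (2 * ‖x - y‖) := by rw [hψxy]
    refine lt_of_mul_lt_mul_right ?_ hpos.le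
    linarith
  have hτd : τ * d ≤ τ := mul_le_of_le_one_right hτ.le hd1
  obtain ⟨p₀, q₀, hne₀, hlt₀⟩ := hM.exists_pair (c := max (L - τ * d + 2 * τ) (M - δ'))
    (le_max_of_le_left (by linarith)) (max_lt hlt (by linarith))
  obtain ⟨p, q, -, hpq, hpqr, -, hpqc⟩ :=
    exists_close_pair_of_steep (f := fun z => f z + τ * ψ z) hne₀ hlt₀ hr'
  have hpos' : 0 < ‖p - q‖ := norm_pos_iff.2 (sub_ne_zero.2 hpq)
  have hc₁ := (mul_le_mul_of_nonneg_right (le_max_left (L - τ * d + 2 * τ) (M - δ'))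
    hpos'.le).trans_lt hpqc
  have hc₂ := (mul_le_mul_of_nonneg_right (le_max_right (L - τ * d + 2 * τ) (M - δ'))
    hpos'.le).trans_lt hpqc
  have hψpq : (2 - d) * ‖p - q‖ < ψ p - ψ q := by
    have h1 := (abs_le.1 (hf.1.2 p q)).2
    rw [dist_eq_norm] at h1
    refine lt_of_mul_lt_mul_left ?_ hτ.le
    linarith
  obtain ⟨hpx, hdir⟩ := hloc p q d hpq hd1 hψpq
  refine ⟨fun z => f z + τ * ψ z, p, q, M, by simp [hf0, hψ0], hM, hpq, hpqr, hc₂, hgf, hpx, ?_⟩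
  by_contra! H
  exact hdir.not_ge (hη _ (norm_smul_inv_norm (𝕜 := ℝ) (sub_ne_zero.2 hxy)) _
    (norm_smul_inv_norm (𝕜 := ℝ) (sub_ne_zero.2 hpq)) H)

theorem exists_steep_sequence [UniformConvexSpace X] {C : ℝ} (hC : 0 < C) :
    ∃ δ > (0 : ℝ), ∀ f : X → ℝ, f 0 = 0 → ∀ L, IsLipNorm f L → ∀ x y : X, x ≠ y →
      (L - δ) * ‖x - y‖ < f x - f y → ‖x - y‖ < C / 2 →
      ∃ (h : ℕ → X → ℝ) (xs ys : ℕ → X) (M : ℕ → ℝ), h 0 = f ∧ xs 0 = x ∧ ys 0 = y ∧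
        ∀ n, h n 0 = 0 ∧ IsLipNorm (h n) (M n) ∧ xs n ≠ ys n ∧
          ‖xs n - ys n‖ < C / 2 / 2 ^ n ∧
          (M n - C / 2 / 2 ^ n) * ‖xs n - ys n‖ < h n (xs n) - h n (ys n) ∧
          (∀ a b, |(h (n + 1) a - h (n + 1) b) - (h n a - h n b)|
            ≤ 2 * (C / 2 / 2 ^ n) * ‖a - b‖) ∧
          ‖xs (n + 1) - xs n‖ < C / 2 / 2 ^ n ∧
          ‖‖xs n - ys n‖⁻¹ • (xs n - ys n) -
            ‖xs (n + 1) - ys (n + 1)‖⁻¹ • (xs (n + 1) - ys (n + 1))‖ < C / 2 / 2 ^ n := by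
  have hρ : ∀ n : ℕ, 0 < C / 2 / 2 ^ n := fun n => by positivity
  have huc : ∀ n : ℕ, ∃ d : ℝ, 0 < d ∧ d ≤ 1 ∧ ∀ u : X, ‖u‖ = 1 → ∀ v : X, ‖v‖ = 1 →
      C / 2 / 2 ^ n ≤ ‖u - v‖ → ‖u + v‖ ≤ 2 - d := fun n => by
    obtain ⟨d, hd, H⟩ := exists_forall_sphere_dist_add_le_two_sub X (hρ n)
    refine ⟨min d 1, lt_min hd one_pos, min_le_right _ _, fun u hu v hv huv => ?_⟩
    linarith [H hu hv huv, min_le_left d 1]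
  choose d hd hd1 huc using huc
  let P : ℕ → (X → ℝ) × X × X × ℝ → Prop := fun n s =>
    s.1 0 = 0 ∧ IsLipNorm s.1 s.2.2.2 ∧ s.2.1 ≠ s.2.2.1 ∧ ‖s.2.1 - s.2.2.1‖ < C / 2 / 2 ^ n ∧
      (s.2.2.2 - C / 2 / 2 ^ n * d n) * ‖s.2.1 - s.2.2.1‖ < s.1 s.2.1 - s.1 s.2.2.1
  have step : ∀ n (s : {s // P n s}), ∃ t : {t // P (n + 1) t},
      (∀ a b, |(t.1.1 a - t.1.1 b) - (s.1.1 a - s.1.1 b)| ≤ 2 * (C / 2 / 2 ^ n) * ‖a - b‖) ∧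
      ‖t.1.2.1 - s.1.2.1‖ < C / 2 / 2 ^ n ∧
      ‖‖s.1.2.1 - s.1.2.2.1‖⁻¹ • (s.1.2.1 - s.1.2.2.1) -
        ‖t.1.2.1 - t.1.2.2.1‖⁻¹ • (t.1.2.1 - t.1.2.2.1)‖ < C / 2 / 2 ^ n := by
    rintro n ⟨⟨f, x, y, L⟩, hf0, hf, hxy, hr, h⟩
    obtain ⟨g, p, q, M, hg0, hg, hpq, hpqr, hst, h1, h2, h3⟩ :=
      hf.exists_perturbation hf0 (hρ n) (hd1 n) (huc n) hxy hr h (hρ (n + 1))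
        (mul_pos (hρ (n + 1)) (hd (n + 1)))
    exact ⟨⟨⟨g, p, q, M⟩, hg0, hg, hpq, hpqr, hst⟩, h1, h2, h3⟩
  choose succ hsucc using step
  refine ⟨C / 2 / 2 ^ 0 * d 0, mul_pos (hρ 0) (hd 0), fun f hf0 L hf x y hxy hst hr => ?_⟩
  let S : ∀ n, {s // P n s} := fun n =>
    Nat.rec (motive := fun n => {s // P n s})
      ⟨⟨f, x, y, L⟩, hf0, hf, hxy, by simpa using hr, hst⟩ succ n
  refine ⟨fun n => (S n).1.1, fun n => (S n).1.2.1, fun n => (S n).1.2.2.1,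
    fun n => (S n).1.2.2.2, rfl, rfl, rfl, fun n => ?_⟩
  obtain ⟨h1, h2, h3, h4, h5⟩ := (S n).2
  refine ⟨h1, h2, h3, h4, lt_of_le_of_lt ?_ h5, hsucc n (S n)⟩
  have := mul_le_of_le_one_right (hρ n).le (hd1 n)
  gcongr

end Normed

theorem stmt18 {X : Type*} [NormedAddCommGroup X] [NormedSpace ℝ X]
    [CompleteSpace X] [UniformConvexSpace X] :
    LocalDirLipBPB X := by
  intro ε hε
  obtain ⟨C, hC, hCε, hC1⟩ : ∃ C : ℝ, 0 < C ∧ 8 * C ≤ ε ∧ 8 * C ≤ 1 :=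
    ⟨min ε 1 / 8, by positivity, by linarith [min_le_left ε 1], by linarith [min_le_right ε 1]⟩
  obtain ⟨δ, hδ, H⟩ := exists_steep_sequence (X := X) hC
  refine ⟨δ, hδ, fun f hf0 hf x y hxy hst => ?_⟩
  have hpos : 0 < ‖x - y‖ := norm_pos_iff.2 (sub_ne_zero.2 hxy)
  obtain ⟨p, q, hp, hpq, hpqr, hdir, hpqst⟩ :=
    exists_close_pair_of_steep hxy ((lt_div_iff₀ hpos).1 hst) (half_pos hC)
  obtain ⟨h, xs, ys, M, h0, hx0, hy0, hseq⟩ := H f hf0 1 hf p q hpq hpqst hpqr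
  choose hh0 hhL hne hclose hsteep hh hxs he using hseq
  let e : ℕ → X := fun n => ‖xs n - ys n‖⁻¹ • (xs n - ys n)
  have hxs' : ∀ n, dist (xs n) (xs (n + 1)) ≤ C / 2 / 2 ^ n := fun n => by
    rw [dist_comm, dist_eq_norm]; exact (hxs n).le
  have he' : ∀ n, dist (e n) (e (n + 1)) ≤ C / 2 / 2 ^ n := fun n => by
    rw [dist_eq_norm]; exact (he n).le
  have hdiff : ∀ a b n, dist (h n a - h n b) (h (n + 1) a - h (n + 1) b)
      ≤ 2 * C * ‖a - b‖ / 2 / 2 ^ n := fun a b n => by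
    rw [dist_comm, Real.dist_eq]; exact (hh n a b).trans_eq (by ring)
  obtain ⟨v, hv⟩ := cauchySeq_tendsto_of_complete (cauchySeq_of_le_geometric_two hxs')
  obtain ⟨u, hu⟩ := cauchySeq_tendsto_of_complete (cauchySeq_of_le_geometric_two he')
  have hlim : ∀ z, ∃ w, Tendsto (fun n => h n z) atTop (𝓝 w) := fun z => by
    have := cauchySeq_of_le_geometric_two (hdiff z 0)
    simp only [hh0, sub_zero] at this
    exact cauchySeq_tendsto_of_complete this
  choose G hG using hlim
  have hGh : ∀ n a b, |(G a - G b) - (h n a - h n b)| ≤ 2 * C / 2 ^ n * ‖a - b‖ := fun n a b => by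
    have := dist_le_of_le_geometric_two_of_tendsto (hdiff a b) ((hG a).sub (hG b)) n
    rw [dist_comm, Real.dist_eq] at this
    exact this.trans_eq (by ring)
  have hG0 : G 0 = 0 := tendsto_nhds_unique (hG 0) (by simp [hh0])
  have hGf : ∀ a b, |(G a - G b) - (f a - f b)| ≤ 2 * C * ‖a - b‖ := fun a b => by
    simpa [h0] using hGh 0 a b
  obtain ⟨L, hL, hL_le⟩ : ∃ L, IsLipNorm G L ∧ L ≤ 1 + 2 * C := by
    refine IsLipNorm.exists_le (by positivity) fun a b => ?_
    have h1 := hGf a b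
    have h2 := hf.1.2 a b
    rw [dist_eq_norm] at *
    rw [abs_le] at *
    constructor <;> linarith
  have hML : ∀ n, L ≤ M n + 2 * C / 2 ^ n := fun n =>
    hL.le_add (hhL n) (by positivity) fun a b => by rw [dist_eq_norm]; exact hGh n a b
  have hL_ge : 1 ≤ L + 2 * C := hf.le_add hL (by positivity) fun a b => by
    rw [dist_eq_norm, abs_sub_comm]; exact hGf a b
  have hLpos : 0 < L := by linarith
  have hvanish : ∀ K : ℝ, Tendsto (fun n : ℕ => K / 2 ^ n) atTop (𝓝 0) := fun K =>
    tendsto_const_nhds.div_atTop (tendsto_pow_atTop_atTop_of_one_lt one_lt_two)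
  have hxy0 : Tendsto (fun n => xs n - ys n) atTop (𝓝 0) :=
    squeeze_zero_norm (fun n => (hclose n).le) (hvanish (C / 2))
  have hslope : Tendsto (fun n => (G (xs n) - G (ys n)) / ‖xs n - ys n‖) atTop (𝓝 L) := by
    have hlow : Tendsto (fun n : ℕ => L - 5 * C / 2 ^ n) atTop (𝓝 L) := by
      simpa using (tendsto_const_nhds (x := L)).sub (hvanish (5 * C))
    refine tendsto_of_tendsto_of_tendsto_of_le_of_le hlow tendsto_const_nhds (fun n => ?_)
      fun n => ?_
    · have hpos : 0 < ‖xs n - ys n‖ := norm_pos_iff.2 (sub_ne_zero.2 (hne n))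
      change _ ≤ (G (xs n) - G (ys n)) / ‖xs n - ys n‖
      rw [le_div_iff₀ hpos]
      have h1 := (abs_le.1 (hGh n (xs n) (ys n))).1
      have h2 := hsteep n
      have h3 : 0 ≤ C / 2 ^ n := by positivity
      have h4 : L - 5 * C / 2 ^ n ≤ M n - C / 2 / 2 ^ n - 2 * C / 2 ^ n := by
        have := hML n
        have e1 : 5 * C / 2 ^ n = 5 * (C / 2 ^ n) := by ring
        have e2 : C / 2 / 2 ^ n = C / 2 ^ n / 2 := by ring
        have e3 : 2 * C / 2 ^ n = 2 * (C / 2 ^ n) := by ring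
        rw [e3] at this
        rw [e1, e2, e3]
        linarith
      have h5 := mul_le_mul_of_nonneg_right h4 hpos.le
      linarith
    · have hpos : 0 < ‖xs n - ys n‖ := norm_pos_iff.2 (sub_ne_zero.2 (hne n))
      change (G (xs n) - G (ys n)) / ‖xs n - ys n‖ ≤ L
      rw [div_le_iff₀ hpos, ← dist_eq_norm]
      exact (abs_le.1 (hL.1.2 _ _)).2
  refine ⟨fun z => G z / L, by simp [hG0], hL.div_self hLpos, v, u, ?_,
    ⟨xs, ys, hne, hv, ?_, hu, ?_⟩, ?_, ?_, ?_⟩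
  · refine tendsto_nhds_unique hu.norm ?_
    have : ∀ n, ‖e n‖ = 1 := fun n => norm_smul_inv_norm (𝕜 := ℝ) (sub_ne_zero.2 (hne n))
    simp [this]
  · simpa using hv.sub hxy0
  · have := hslope.div_const L
    rw [_root_.div_self hLpos.ne'] at this
    refine this.congr fun n => ?_
    ring
  · obtain ⟨N, hN, hNle⟩ : ∃ N, IsLipNorm (fun z => G z / L - f z) N ∧ N ≤ 4 * C := by
      refine IsLipNorm.exists_le (by positivity) fun a b => ?_
      have h1 := hGf a b
      have h2 : |(G a - G b) / L - (G a - G b)| ≤ 2 * C * ‖a - b‖ := by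
        have h3 := (hL.div_self hLpos).1.2 a b
        rw [← sub_div, one_mul, dist_eq_norm] at h3
        calc _ = |(1 - L) * ((G a - G b) / L)| := by congr 1; field_simp
          _ = |1 - L| * |(G a - G b) / L| := abs_mul _ _
          _ ≤ 2 * C * ‖a - b‖ := by
            gcongr
            exact abs_le.2 ⟨by linarith, by linarith⟩
      rw [dist_eq_norm]
      rw [sub_div] at h2
      rw [abs_le] at *
      constructor <;> linarith
    exact ⟨N, hN, by linarith⟩
  · have := dist_le_of_le_geometric_two_of_tendsto₀ he' hu
    simp only [e, hx0, hy0, hdir, dist_eq_norm] at this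
    linarith
  · have := dist_le_of_le_geometric_two_of_tendsto₀ hxs' hv
    rw [hx0, dist_comm] at this
    linarith [Metric.infDist_le_dist_of_mem (x := v) hp]
end

section
/- Let X be a uniformly convex real Banach space with X ≠ {0}. Then the set of Lipschitz functionals which attain their norm directionally is dense in Lip_0(X): for every f ∈ Lip_0(X) and every ε > 0 there exists g ∈ Lip_0(X) which attains its norm directionally and satisfies ‖f-g‖ < ε. -/
open Filter Topology

/-- `g` (with Lipschitz norm `L`) attains its norm at the direction `u`. -/
def AttainsAtDirection {X : Type*} [NormedAddCommGroup X] [NormedSpace ℝ X]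
    (g : X → ℝ) (L : ℝ) (u : X) : Prop :=
  ∃ xs ys : ℕ → X, (∀ n, xs n ≠ ys n) ∧
    Tendsto (fun n => ‖xs n - ys n‖⁻¹ • (xs n - ys n)) atTop (𝓝 u) ∧
    Tendsto (fun n => (g (xs n) - g (ys n)) / ‖xs n - ys n‖) atTop (𝓝 L)

/-- A function admitting a Lipschitz constant has a smallest one. -/
theorem exists_isLipNorm {E : Type*} [PseudoMetricSpace E] {f : E → ℝ} {K : ℝ} (hK : 0 ≤ K)
    (h : ∀ x y, |f x - f y| ≤ K * dist x y) : ∃ L, IsLipNorm f L := by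
  have hcl : IsClosed {K : ℝ | 0 ≤ K ∧ ∀ x y : E, |f x - f y| ≤ K * dist x y} := by
    simp only [Set.ofPred_and, Set.ofPred_forall]
    refine isClosed_Ici.inter (isClosed_iInter fun x => isClosed_iInter fun y => ?_)
    exact isClosed_le continuous_const (by fun_prop)
  have hb : BddBelow {K : ℝ | 0 ≤ K ∧ ∀ x y : E, |f x - f y| ≤ K * dist x y} :=
    ⟨0, fun _ h => h.1⟩
  exact ⟨_, hcl.csInf_mem ⟨K, hK, h⟩ hb, fun _ h => csInf_le hb h⟩

theorem exists_lipschitz_slope_ge {X : Type*} [NormedAddCommGroup X] [Nontrivial X]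
    {h : X → ℝ} {N η : ℝ} (hN : IsLipNorm h N) (hη : 0 < η) :
    ∃ x y : X, x ≠ y ∧ (N - η) * ‖x - y‖ ≤ h x - h y := by
  obtain ⟨x, y, hxy, hle⟩ : ∃ x y : X, x ≠ y ∧ (N - η) * ‖x - y‖ ≤ |h x - h y| := by
    by_cases h0 : 0 ≤ N - η
    · by_contra! hc
      have : N ≤ N - η := by
        refine hN.2 ⟨h0, fun x y => ?_⟩
        rcases eq_or_ne x y with rfl | hne
        · simp
        · rw [dist_eq_norm]
          exact (hc x y hne).le
      linarith
    · obtain ⟨x, y, hxy⟩ := exists_pair_ne X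
      refine ⟨x, y, hxy, le_trans ?_ (abs_nonneg _)⟩
      exact mul_nonpos_of_nonpos_of_nonneg (not_le.1 h0).le (norm_nonneg _)
  rcases le_total 0 (h x - h y) with hs | hs
  · exact ⟨x, y, hxy, by rwa [abs_of_nonneg hs] at hle⟩
  · refine ⟨y, x, hxy.symm, ?_⟩
    rw [abs_of_nonpos hs, norm_sub_rev] at hle
    linarith

/-- A positive sequence can be dominated by consecutive sums of a positive null sequence. -/
theorem exists_pos_tendsto_zero_add_succ_lt {c : ℕ → ℝ} (hc : ∀ n, 0 < c n) :
    ∃ η : ℕ → ℝ, (∀ n, 0 < η n) ∧ Tendsto η atTop (𝓝 0) ∧ ∀ n, η n + η (n + 1) < c n := by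
  let η : ℕ → ℝ := fun n => Nat.rec (min 1 (c 0 / 2)) (fun k r => min (r / 2) (c (k + 1) / 2)) n
  have hs : ∀ n, η (n + 1) = min (η n / 2) (c (n + 1) / 2) := fun n => rfl
  have hpos : ∀ n, 0 < η n := by
    intro n
    induction n with
    | zero => exact lt_min one_pos (half_pos (hc 0))
    | succ n ih => rw [hs]; exact lt_min (half_pos ih) (half_pos (hc _))
  have hhalf : ∀ n, η (n + 1) ≤ η n / 2 := fun n => (hs n).trans_le (min_le_left _ _)
  have hle : ∀ n, η n ≤ c n / 2 := by
    intro n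
    cases n with
    | zero => exact min_le_right _ _
    | succ n => rw [hs]; exact min_le_right _ _
  have hpow : ∀ n, η n ≤ (1 / 2) ^ n := by
    intro n
    induction n with
    | zero => exact (min_le_left _ _).trans (by simp)
    | succ n ih => rw [pow_succ]; linarith [hhalf n]
  refine ⟨η, hpos, ?_, fun n => by linarith [hhalf n, hle n, hpos n]⟩
  exact squeeze_zero (fun n => (hpos n).le) hpow
    (tendsto_pow_atTop_nhds_zero_of_lt_one (by norm_num) (by norm_num))

theorem stmt19 {X : Type*} [NormedAddCommGroup X] [NormedSpace ℝ X]
    [CompleteSpace X] [UniformConvexSpace X] [Nontrivial X]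
    (f : X → ℝ) (hf0 : f 0 = 0) (L : ℝ) (hfL : IsLipNorm f L)
    (ε : ℝ) (hε : 0 < ε) :
    ∃ g : X → ℝ, g 0 = 0 ∧
      (∃ (L' : ℝ) (u : X), ‖u‖ = 1 ∧ IsLipNorm g L' ∧ AttainsAtDirection g L' u) ∧
      ∃ M : ℝ, IsLipNorm (fun z => f z - g z) M ∧ M < ε := by
  have hex : ∀ ψ : X →L[ℝ] ℝ, ∃ N, IsLipNorm (fun z => f z + ψ z) N := by
    intro ψ
    refine exists_isLipNorm (K := L + ‖ψ‖) (add_nonneg hfL.1.1 (norm_nonneg _)) fun x y => ?_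
    have h1 := hfL.1.2 x y
    have h2 := ψ.le_opNorm (x - y)
    rw [Real.norm_eq_abs, map_sub, ← dist_eq_norm] at h2
    calc |f x + ψ x - (f y + ψ y)| = |(f x - f y) + (ψ x - ψ y)| := by ring_nf
      _ ≤ |f x - f y| + |ψ x - ψ y| := abs_add_le _ _
      _ ≤ (L + ‖ψ‖) * dist x y := by linarith
  choose N hN using hex
  have hslope : ∀ ψ x y, f x + ψ x - (f y + ψ y) ≤ N ψ * ‖x - y‖ := fun ψ x y => by
    have := (hN ψ).1.2 x y
    rw [dist_eq_norm] at this
    exact (le_abs_self _).trans this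
  have hNlip : ∀ ψ ψ', N ψ ≤ N ψ' + ‖ψ - ψ'‖ := by
    intro ψ ψ'
    refine (hN ψ).2 ⟨add_nonneg (hN ψ').1.1 (norm_nonneg _), fun x y => ?_⟩
    have h1 := (hN ψ').1.2 x y
    have h2 := (ψ - ψ').le_opNorm (x - y)
    rw [Real.norm_eq_abs, ← dist_eq_norm x y] at h2
    calc |f x + ψ x - (f y + ψ y)|
        = |(f x + ψ' x - (f y + ψ' y)) + (ψ - ψ') (x - y)| := by
          simp only [sub_apply, map_sub]; ring_nf
      _ ≤ |f x + ψ' x - (f y + ψ' y)| + |(ψ - ψ') (x - y)| := abs_add_le _ _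
      _ ≤ (N ψ' + ‖ψ - ψ'‖) * dist x y := by linarith
  choose δ hδ hUC using fun n : ℕ =>
    exists_forall_sphere_dist_add_le_two_sub X (show (0 : ℝ) < 1 / 2 / 2 ^ n by positivity)
  let e : ℕ → ℝ := fun n => ε / 2 / 2 / 2 ^ n
  have he : ∀ n, 0 < e n := fun n => by positivity
  obtain ⟨η, hη, hη0, hηsum⟩ :=
    exists_pos_tendsto_zero_add_succ_lt (fun n => mul_pos (he n) (hδ n))
  have hstep : ∀ (n : ℕ) (ψ : X →L[ℝ] ℝ), ∃ (x y : X) (φ : X →L[ℝ] ℝ), x ≠ y ∧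
      (N ψ - η n) * ‖x - y‖ ≤ f x + ψ x - (f y + ψ y) ∧ ‖φ‖ = 1 ∧ φ (x - y) = ‖x - y‖ := by
    intro n ψ
    obtain ⟨x, y, hxy, h⟩ := exists_lipschitz_slope_ge (hN ψ) (hη n)
    obtain ⟨φ, hφ, hφx⟩ := exists_dual_vector ℝ (x - y) (norm_ne_zero_iff.2 (sub_ne_zero.2 hxy))
    exact ⟨x, y, φ, hxy, h, hφ, by simpa using hφx⟩
  choose x y φ hxy hatt hφ hφx using hstep
  let Ψ : ℕ → X →L[ℝ] ℝ := fun n => Nat.rec 0 (fun k ψ => ψ + e k • φ k ψ) n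
  have hΨ : ∀ n, Ψ (n + 1) = Ψ n + e n • φ n (Ψ n) := fun n => rfl
  have hΨdist : ∀ n, dist (Ψ n) (Ψ (n + 1)) ≤ ε / 2 / 2 / 2 ^ n := by
    intro n
    rw [dist_comm, dist_eq_norm, hΨ, add_sub_cancel_left, norm_smul, hφ, mul_one,
      Real.norm_of_nonneg (he n).le]
  obtain ⟨Φ, hΦ⟩ := cauchySeq_tendsto_of_complete (cauchySeq_of_le_geometric_two hΨdist)
  have hΦnorm : ‖Φ‖ ≤ ε / 2 := by
    have := dist_le_of_le_geometric_two_of_tendsto₀ hΨdist hΦ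
    rwa [show Ψ 0 = 0 from rfl, dist_zero_left] at this
  let p : ℕ → X := fun n => x n (Ψ n)
  let q : ℕ → X := fun n => y n (Ψ n)
  have hpos : ∀ n, 0 < ‖p n - q n‖ := fun n => norm_pos_iff.2 (sub_ne_zero.2 (hxy n (Ψ n)))
  let u : ℕ → X := fun n => ‖p n - q n‖⁻¹ • (p n - q n)
  have hu1 : ∀ n, ‖u n‖ = 1 := fun n => norm_smul_inv_norm (𝕜 := ℝ) (norm_pos_iff.1 (hpos n))
  have hφu : ∀ n, φ n (Ψ n) (u n) = 1 := by
    intro n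
    simp only [u, map_smul, smul_eq_mul]
    rw [show φ n (Ψ n) (p n - q n) = ‖p n - q n‖ from hφx n (Ψ n)]
    exact inv_mul_cancel₀ (hpos n).ne'
  have hφu' : ∀ n, 1 - δ n < φ n (Ψ n) (u (n + 1)) := by
    intro n
    have hgrow : N (Ψ n) - η n + e n ≤ N (Ψ (n + 1)) := by
      have h1 := hatt n (Ψ n)
      have h2 := hslope (Ψ (n + 1)) (p n) (q n)
      have h3 := hφx n (Ψ n)
      rw [map_sub] at h3
      simp only [hΨ, add_apply, smul_apply,
        smul_eq_mul] at h2
      refine le_of_mul_le_mul_right ?_ (hpos n)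
      calc (N (Ψ n) - η n + e n) * ‖p n - q n‖
          ≤ f (p n) + Ψ n (p n) - (f (q n) + Ψ n (q n)) + e n * ‖p n - q n‖ := by
            rw [add_mul]; exact add_le_add_left h1 _
        _ = _ := by
            change _ + e n * ‖x n (Ψ n) - y n (Ψ n)‖ = _
            rw [← h3]
        _ ≤ _ := by
            refine le_trans (le_of_eq ?_) h2
            simp only [p, q]
            ring
    have h1 := hatt (n + 1) (Ψ (n + 1))
    have h2 := hslope (Ψ n) (p (n + 1)) (q (n + 1))
    have h3 : f (p (n + 1)) + Ψ (n + 1) (p (n + 1)) - (f (q (n + 1)) + Ψ (n + 1) (q (n + 1)))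
        = (f (p (n + 1)) + Ψ n (p (n + 1)) - (f (q (n + 1)) + Ψ n (q (n + 1))))
          + e n * φ n (Ψ n) (u (n + 1)) * ‖p (n + 1) - q (n + 1)‖ := by
      have : φ n (Ψ n) (u (n + 1)) * ‖p (n + 1) - q (n + 1)‖
          = φ n (Ψ n) (p (n + 1)) - φ n (Ψ n) (q (n + 1)) := by
        have := (hpos (n + 1)).ne'
        simp only [u, map_smul, smul_eq_mul, map_sub]
        field_simp
      rw [mul_assoc, this]
      simp only [hΨ, add_apply, smul_apply, smul_eq_mul]
      ring
    have h4 : N (Ψ (n + 1)) - η (n + 1) ≤ N (Ψ n) + e n * φ n (Ψ n) (u (n + 1)) := by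
      refine le_of_mul_le_mul_right ?_ (hpos (n + 1))
      refine h1.trans ?_
      rw [add_mul]
      exact h3.le.trans (add_le_add_left h2 _)
    have h5 := hηsum n
    refine lt_of_mul_lt_mul_left ?_ (he n).le
    linarith
  have hudist : ∀ n, dist (u n) (u (n + 1)) ≤ 1 / 2 / 2 ^ n := by
    intro n
    by_contra! hc
    rw [dist_eq_norm] at hc
    have h1 := hUC n (hu1 n) (hu1 (n + 1)) hc.le
    have h2 := (le_abs_self _).trans ((φ n (Ψ n)).le_opNorm (u n + u (n + 1)))
    rw [hφ, map_add, hφu, one_mul] at h2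
    linarith [hφu' n]
  obtain ⟨v, hv⟩ := cauchySeq_tendsto_of_complete (cauchySeq_of_le_geometric_two hudist)
  have hdist0 : Tendsto (fun n => ‖Ψ n - Φ‖) atTop (𝓝 0) := tendsto_iff_norm_sub_tendsto_zero.1 hΦ
  refine ⟨fun z => f z + Φ z, by simp [hf0], ⟨N Φ, v, ?_, hN Φ, p, q, fun n => hxy n (Ψ n), hv, ?_⟩,
    ?_⟩
  · exact tendsto_nhds_unique hv.norm (by simp [hu1])
  · have hlow : Tendsto (fun n => N Φ - ‖Ψ n - Φ‖ - η n - ‖Ψ n - Φ‖) atTop (𝓝 (N Φ)) := by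
      simpa using ((tendsto_const_nhds.sub hdist0).sub hη0).sub hdist0
    refine tendsto_of_tendsto_of_tendsto_of_le_of_le hlow tendsto_const_nhds (fun n => ?_)
      (fun n => ?_)
    · simp only
      rw [le_div_iff₀ (hpos n)]
      have h1 := hatt n (Ψ n)
      have h2 := (le_abs_self _).trans ((Ψ n - Φ).le_opNorm (p n - q n))
      simp only [sub_apply, map_sub] at h2
      have h3 := mul_le_mul_of_nonneg_right (hNlip Φ (Ψ n)) (hpos n).le
      rw [norm_sub_rev Φ (Ψ n)] at h3
      simp only [p, q] at *
      linarith
    · exact (div_le_iff₀ (hpos n)).2 (hslope Φ (p n) (q n))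
  · have hK : ∀ a b, |f a - (f a + Φ a) - (f b - (f b + Φ b))| ≤ ‖Φ‖ * dist a b := by
      intro a b
      have h := Φ.le_opNorm (b - a)
      rw [Real.norm_eq_abs, map_sub, ← dist_eq_norm, dist_comm] at h
      convert h using 2
      ring
    obtain ⟨M, hM⟩ := exists_isLipNorm (f := fun z => f z - (f z + Φ z)) (norm_nonneg Φ) hK
    have hMle : M ≤ ‖Φ‖ := hM.2 ⟨norm_nonneg Φ, hK⟩
    exact ⟨M, hM, by linarith⟩
end
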